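/- arXiv:2402.16085 — 4 statements merged into one kernel-verified Lean document; each statement's English description precedes it below -/
import Mathlib

section
/- Let B > 0 be a real number and let cs be a finite list of real numbers, each lying in the half-open interval (0, B]. Then cs can be partitioned into consecutive nonempty blocks (contiguous sublists whose concatenation is cs) such that the sum of each block is at most B and, for any two consecutive blocks, the sum of their two block-sums strictly exceeds B. -/
/-- A list of items in `(0, B]` splits into consecutive nonempty blocks of sum at most `B`, any two
adjacent ones exceeding `B` together: process the list from the right, adding each item to the
leading block when it fits and opening a new block otherwise. -/
theorem exists_flatten_eq_isChain_lt_sum_add_sum (B : ℝ) (cs : List ℝ)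
    (hcs : ∀ x ∈ cs, 0 < x ∧ x ≤ B) :
    ∃ bs : List (List ℝ), bs.flatten = cs ∧ (∀ b ∈ bs, b ≠ []) ∧ (∀ b ∈ bs, b.sum ≤ B) ∧
      bs.IsChain (fun a b => B < a.sum + b.sum) := by
  induction cs with
  | nil => exact ⟨[], by simp⟩
  | cons x cs ih =>
    obtain ⟨hx, hxs⟩ := List.forall_mem_cons.1 hcs
    obtain ⟨bs, rfl, hne, hle, hchain⟩ := ih hxs
    cases bs with
    | nil => exact ⟨[[x]], by simp [hx.2]⟩
    | cons b bs =>
      rw [List.forall_mem_cons] at hne hle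
      by_cases h : x + b.sum ≤ B
      · refine ⟨(x :: b) :: bs, by simp, ?_, ?_, ?_⟩
        · simpa using hne.2
        · simpa [h] using hle.2
        · rw [List.isChain_cons] at hchain ⊢
          refine ⟨fun y hy => ?_, hchain.2⟩
          have := hchain.1 y hy
          rw [List.sum_cons]
          linarith [hx.1]
      · refine ⟨[x] :: b :: bs, by simp, ?_, ?_, ?_⟩
        · simpa using hne
        · simpa [hx.2] using hle
        · exact List.isChain_cons_cons.2 ⟨by simpa using h, hchain⟩

/-- Next-fit produces a partition of the item list into consecutive nonempty blocks (bins)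
such that each bin's sum is at most `B`, and any two consecutive bins together strictly
exceed `B`. -/
theorem next_fit_partition_exists (B : ℝ) (hB : 0 < B) (cs : List ℝ)
    (hcs : ∀ x ∈ cs, 0 < x ∧ x ≤ B) :
    ∃ bs : List (List ℝ),
      bs.flatten = cs ∧
      (∀ b ∈ bs, b ≠ []) ∧
      (∀ b ∈ bs, b.sum ≤ B) ∧
      (∀ (i : ℕ) (h : i + 1 < bs.length),
        (bs.get ⟨i, Nat.lt_of_succ_lt h⟩).sum + (bs.get ⟨i + 1, h⟩).sum > B) := by
  obtain ⟨bs, hflat, hne, hle, hchain⟩ := exists_flatten_eq_isChain_lt_sum_add_sum B cs hcs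
  exact ⟨bs, hflat, hne, hle, fun i h => List.isChain_iff_getElem.1 hchain i h⟩
end

section
/- Let ι be a finite index type and l r : ι → ℝ with l i ≤ r i for all i, where the values l i are pairwise distinct. Then there exists a proper coloring f : ι → ℕ (any two distinct overlapping intervals receive different colors) such that for every i, f i is at most the number of indices j with l j ≤ l i ≤ r j. In particular, the number of colors used is at most the maximum, over i, of the load at the left endpoint l i. -/
open Finset

/-- First-fit coloring along a key `l`: each index avoids the colors of the
earlier indices related to it, and its color is at most the number of those indices. -/
theorem exists_greedy_coloring {ι α : Type*} [Fintype ι] [LinearOrder α] (l : ι → α)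
    (R : ι → ι → Prop) [DecidableRel R] :
    ∃ f : ι → ℕ, (∀ i j, l j < l i → R i j → f i ≠ f j) ∧
      ∀ i, f i ≤ #{j | l j < l i ∧ R i j} := by
  classical
  suffices h : ∀ s : Finset ι, ∃ f : ι → ℕ,
      (∀ i ∈ s, ∀ j ∈ s, l j < l i → R i j → f i ≠ f j) ∧
        ∀ i ∈ s, f i ≤ #{j | l j < l i ∧ R i j} by
    simpa using h univ
  intro s
  induction s using Finset.induction_on_max_value l with
  | empty => exact ⟨0, by simp⟩
  | insert a s ha hmax ih =>
    obtain ⟨f, hf, hcard⟩ := ih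
    let T : Finset ℕ := ({j | l j < l a ∧ R a j} : Finset ι).image f
    obtain ⟨n, hn, hnT⟩ : ∃ n ∈ range (#T + 1), n ∉ T :=
      Finset.exists_mem_notMem_of_card_lt_card (by simp)
    have hne : ∀ i ∈ s, i ≠ a := fun i hi h => ha (h ▸ hi)
    refine ⟨Function.update f a n, ?_, ?_⟩
    · intro i hi j hj hlt hR
      rcases Finset.mem_insert.1 hi with rfl | his
      · have hji : j ≠ i := fun h => hlt.ne (congrArg l h)
        rw [Function.update_self, Function.update_of_ne hji]
        rintro rfl
        exact hnT (Finset.mem_image_of_mem f (by simp [hlt, hR]))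
      · rcases Finset.mem_insert.1 hj with rfl | hjs
        · exact absurd hlt (hmax i his).not_gt
        · rw [Function.update_of_ne (hne i his), Function.update_of_ne (hne j hjs)]
          exact hf i his j hjs hlt hR
    · intro i hi
      rcases Finset.mem_insert.1 hi with rfl | his
      · rw [Function.update_self]
        exact (Nat.lt_succ_iff.1 (Finset.mem_range.1 hn)).trans Finset.card_image_le
      · rw [Function.update_of_ne (hne i his)]
        exact hcard i his

/-- Greedy interval coloring bound (Lemma 3): for a finite family of intervals
`[l i, r i]` with pairwise distinct left endpoints, there is a proper coloring
`f : ι → ℕ` such that each `f i` is at most the load at the point `l i`, i.e.,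
the number of indices `j` with `l j ≤ l i ≤ r j`. -/
theorem greedy_interval_coloring (ι : Type*) [Fintype ι]
    (l r : ι → ℝ) (hlr : ∀ i, l i ≤ r i)
    (hinj : Function.Injective l) :
    ∃ f : ι → ℕ,
      (∀ i j : ι, i ≠ j → (Set.Icc (l i) (r i) ∩ Set.Icc (l j) (r j)).Nonempty →
        f i ≠ f j) ∧
      (∀ i : ι, f i ≤ (Finset.univ.filter (fun j => l j ≤ l i ∧ l i ≤ r j)).card) := by
  classical
  obtain ⟨f, hf, hcard⟩ := exists_greedy_coloring l (fun i j => l i ≤ r j)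
  refine ⟨f, ?_, fun i => (hcard i).trans (Finset.card_le_card ?_)⟩
  · rintro i j hij ⟨t, ⟨hit, hti⟩, hjt, htj⟩
    rcases lt_or_gt_of_ne (hinj.ne hij) with h | h
    · exact (hf j i h (hjt.trans hti)).symm
    · exact hf i j h (hit.trans htj)
  · exact Finset.monotone_filter_right _ fun j _ h => ⟨h.1.le, h.2⟩
end

section
/- Let ι be a finite index type, l r : ι → ℝ with l i ≤ r i for all i, c : ι → ℝ with 0 ≤ c i ≤ B for all i, and B > 0 real. Suppose an assignment gives each interval i a pair (id i, bin i) with id i ∈ Fin g and bin i ∈ Fin (L (id i)), such that: (1) any two distinct intervals with the same id are disjoint (their closed intervals do not intersect); (2) for every pair (q, b), the total cost of intervals i with id i = q and bin i = b is at most B; (3) for every q ∈ Fin g, every bin number in Fin (L q) is used by some interval, and for consecutive bin numbers b, b' of group q, the total cost of bin b plus the total cost of bin b' strictly exceeds B; (4) g is at most the maximum, over i ∈ ι, of the number of indices j with l j ≤ l i ≤ r j. Then for every natural number m and every function f : ι → Fin m such that any two distinct overlapping intervals receive different f-values and every f-class has total cost at most B, we have ∑ q, L q ≤ 3 · m. 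-/
open Finset

/-- If any two consecutive terms of a nonnegative sequence add up to at least `B`, then its first
`n` terms add up to at least `(n / 2) * B`. -/
theorem half_mul_le_sum_range_of_le_consecutive {s : ℕ → ℝ} {B : ℝ} (hs : ∀ b, 0 ≤ s b) (n : ℕ)
    (h : ∀ b, b + 1 < n → B ≤ s b + s (b + 1)) :
    ((n / 2 : ℕ) : ℝ) * B ≤ ∑ b ∈ Finset.range n, s b := by
  induction n using Nat.twoStepInduction with
  | zero => simp
  | one => simpa using hs 0
  | more n ih _ =>
    have ih := ih fun b hb => h b (by omega)
    have hn := h n (by omega)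
    rw [Finset.sum_range_succ, Finset.sum_range_succ, Nat.add_div_right n two_pos]
    push_cast
    linarith

/-- The intervals containing a common point need pairwise distinct colors, so the point load at
a left endpoint is at most the number of colors. -/
theorem sup_point_load_le_of_proper_coloring {ι : Type*} [Fintype ι] {l r : ι → ℝ} {m : ℕ}
    {f : ι → Fin m}
    (hf : ∀ i j : ι, i ≠ j → (Set.Icc (l i) (r i) ∩ Set.Icc (l j) (r j)).Nonempty →
      f i ≠ f j) :
    Finset.univ.sup
      (fun i => (Finset.univ.filter (fun j => l j ≤ l i ∧ l i ≤ r j)).card) ≤ m := by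
  refine Finset.sup_le fun i _ => ?_
  calc _ ≤ (Finset.univ : Finset (Fin m)).card := by
        refine Finset.card_le_card_of_injOn f (fun _ _ => Finset.mem_coe.2 (Finset.mem_univ _)) ?_
        intro j hj k hk hjk
        by_contra hne
        simp only [Finset.coe_filter, Finset.mem_univ, true_and, Set.mem_ofPred_eq] at hj hk
        exact hf j k hne ⟨l i, hj, hk⟩ hjk
    _ = m := by simp

/-- Theorem 1 (3-competitiveness of DSusingBPC): suppose each interval `i` gets a color
`(id i, bin i)` such that (1) intervals sharing an `id` are pairwise disjoint; (2) every
bin respects the budget `B`; (3) every bin number is used and consecutive bins of a group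
have combined load exceeding `B` (next-fit property); and (4) the number `g` of ids is at
most the maximum point load at a left endpoint. Then the total number of bins used,
`∑ q, L q`, is at most `3 · m` for any feasible offline `B`-budgeted proper coloring
with `m` colors. -/
theorem dsusingbpc_three_competitive (ι : Type*) [Fintype ι] [DecidableEq ι]
    (l r : ι → ℝ) (hlr : ∀ i, l i ≤ r i)
    (B : ℝ) (hB : 0 < B) (c : ι → ℝ) (hc : ∀ i, 0 ≤ c i ∧ c i ≤ B)
    (g : ℕ) (L : Fin g → ℕ)
    (id : ι → Fin g) (bin : ι → ℕ) (hbin : ∀ i, bin i < L (id i))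
    (h1 : ∀ i j : ι, i ≠ j → id i = id j →
      Set.Icc (l i) (r i) ∩ Set.Icc (l j) (r j) = ∅)
    (h2 : ∀ (q : Fin g) (b : ℕ), b < L q →
      ∑ i ∈ Finset.univ.filter (fun i => id i = q ∧ bin i = b), c i ≤ B)
    (h3used : ∀ (q : Fin g) (b : ℕ), b < L q → ∃ i : ι, id i = q ∧ bin i = b)
    (h3consec : ∀ (q : Fin g) (b : ℕ), b + 1 < L q →
      (∑ i ∈ Finset.univ.filter (fun i => id i = q ∧ bin i = b), c i) +
        (∑ i ∈ Finset.univ.filter (fun i => id i = q ∧ bin i = b + 1), c i) > B)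
    (h4 : g ≤ Finset.univ.sup
      (fun i => (Finset.univ.filter (fun j => l j ≤ l i ∧ l i ≤ r j)).card)) :
    ∀ (m : ℕ) (f : ι → Fin m),
      (∀ i j : ι, i ≠ j → (Set.Icc (l i) (r i) ∩ Set.Icc (l j) (r j)).Nonempty →
        f i ≠ f j) →
      (∀ p : Fin m, ∑ i ∈ Finset.univ.filter (fun i => f i = p), c i ≤ B) →
      ∑ q, L q ≤ 3 * m := by
  intro m f hf hfB
  have hgm : g ≤ m := h4.trans (sup_point_load_le_of_proper_coloring hf)
  have hgroup : ∀ q : Fin g,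
      ((L q / 2 : ℕ) : ℝ) * B ≤ ∑ i ∈ Finset.univ.filter (fun i => id i = q), c i := by
    intro q
    have hfib : ∑ b ∈ Finset.range (L q),
        ∑ i ∈ Finset.univ.filter (fun i => id i = q ∧ bin i = b), c i =
          ∑ i ∈ Finset.univ.filter (fun i => id i = q), c i := by
      simp only [← Finset.filter_filter]
      refine Finset.sum_fiberwise_of_maps_to (fun i hi => ?_) c
      simp only [Finset.mem_filter, Finset.mem_univ, true_and] at hi
      exact Finset.mem_range.2 (hi ▸ hbin i)
    rw [← hfib]
    exact half_mul_le_sum_range_of_le_consecutive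
      (fun b => Finset.sum_nonneg fun i _ => (hc i).1) (L q) fun b hb => (h3consec q b hb).le
  have hhalf : ∑ q, L q / 2 ≤ m := by
    have hmul : ((∑ q, L q / 2 : ℕ) : ℝ) * B ≤ m * B := by
      calc ((∑ q, L q / 2 : ℕ) : ℝ) * B = ∑ q, ((L q / 2 : ℕ) : ℝ) * B := by
            rw [Nat.cast_sum, Finset.sum_mul]
        _ ≤ ∑ q, ∑ i ∈ Finset.univ.filter (fun i => id i = q), c i :=
            Finset.sum_le_sum fun q _ => hgroup q
        _ = ∑ p, ∑ i ∈ Finset.univ.filter (fun i => f i = p), c i := by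
            rw [Finset.sum_fiberwise, Finset.sum_fiberwise]
        _ ≤ ∑ _p : Fin m, B := Finset.sum_le_sum fun p _ => hfB p
        _ = m * B := by simp
    exact_mod_cast le_of_mul_le_mul_right hmul hB
  calc ∑ q, L q ≤ ∑ q, (2 * (L q / 2) + 1) := Finset.sum_le_sum fun q _ => by omega
    _ = 2 * ∑ q, L q / 2 + g := by simp [Finset.sum_add_distrib, Finset.mul_sum]
    _ ≤ 3 * m := by omega
end

section
/- Let g ≥ 1 be a natural number, and for each i ∈ Fin g let L i ≥ 1 be a natural number, c i : Fin (L i) → ℝ with c i j ≥ 0, and Bcap i assign a real capacity to each j ∈ Fin (L i). Let Bmin and Bmax be reals with 0 < Bmin ≤ Bcap i j ≤ Bmax for all i, j, and set α = Bmax / Bmin. Assume that for every i and every pair of consecutive indices j, j' in Fin (L i), c i j + c i j' > Bcap i j. Let OPT be a real number with OPT ≥ g and OPT · Bmax ≥ ∑ i, ∑ j, c i j. Then ∑ i, (L i : ℝ) ≤ (2 · α + 1) · OPT. -/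
open Finset

/-- If consecutive terms of a nonnegative finite sequence sum to at least `B`, then the number of
consecutive pairs times `B` is at most twice the total. -/
theorem sub_one_mul_le_two_mul_sum {n : ℕ} (hn : 1 ≤ n) (c : Fin n → ℝ) (hc : ∀ j, 0 ≤ c j)
    (B : ℝ) (h : ∀ (j : Fin n) (hj : j.val + 1 < n), B ≤ c j + c ⟨j.val + 1, hj⟩) :
    ((n : ℝ) - 1) * B ≤ 2 * ∑ j, c j := by
  obtain ⟨m, rfl⟩ : ∃ m, n = m + 1 := ⟨n - 1, by omega⟩
  have hpairs : ∑ _j : Fin m, B ≤ ∑ j : Fin m, (c j.castSucc + c j.succ) :=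
    sum_le_sum fun j _ => h j.castSucc (Nat.succ_lt_succ j.isLt)
  rw [sum_add_distrib, sum_const, card_univ, Fintype.card_fin, nsmul_eq_mul] at hpairs
  have hlast := Fin.sum_univ_castSucc c
  have hfirst := Fin.sum_univ_succ c
  have := hc 0
  have := hc (Fin.last m)
  push_cast
  linarith

/-- Theorem 3 ((2α+1)-competitiveness of VariableSizeDS): `g ≥ 1` groups are packed into
`L i ≥ 1` variable-size bins with nonnegative loads `c i j` and capacities
`Bcap i j ∈ [Bmin, Bmax]`, where consecutive bins of a group have combined load
exceeding the earlier bin's capacity. If `OPT ≥ g` and `OPT · Bmax ≥ ∑ i, ∑ j, c i j`,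
then `∑ i, L i ≤ (2α + 1) · OPT` with `α = Bmax / Bmin`. -/
theorem variable_size_ds_competitive (g : ℕ) (hg : 1 ≤ g)
    (L : Fin g → ℕ) (hL : ∀ i, 1 ≤ L i)
    (c : ∀ i : Fin g, Fin (L i) → ℝ) (hc : ∀ i j, 0 ≤ c i j)
    (Bcap : ∀ i : Fin g, Fin (L i) → ℝ)
    (Bmin Bmax : ℝ) (hBmin : 0 < Bmin)
    (hcap : ∀ (i : Fin g) (j : Fin (L i)), Bmin ≤ Bcap i j ∧ Bcap i j ≤ Bmax)
    (α : ℝ) (hα : α = Bmax / Bmin)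
    (hconsec : ∀ (i : Fin g) (j : Fin (L i)) (h : j.val + 1 < L i),
      c i j + c i ⟨j.val + 1, h⟩ > Bcap i j)
    (OPT : ℝ) (hOPTg : (g : ℝ) ≤ OPT)
    (hOPTvol : ∑ i, ∑ j, c i j ≤ OPT * Bmax) :
    (∑ i, (L i : ℝ)) ≤ (2 * α + 1) * OPT := by
  have hgroup (i : Fin g) : ((L i : ℝ) - 1) * Bmin ≤ 2 * ∑ j, c i j :=
    sub_one_mul_le_two_mul_sum (hL i) (c i) (hc i) Bmin fun j hj =>
      (hcap i j).1.trans (hconsec i j hj).le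
  have hsum := sum_le_sum fun i (_ : i ∈ univ) => hgroup i
  rw [← sum_mul, ← mul_sum, sum_sub_distrib, sum_const, card_univ, Fintype.card_fin,
    nsmul_eq_mul, mul_one] at hsum
  have hαB : α * Bmin = Bmax := by rw [hα, div_mul_cancel₀ _ hBmin.ne']
  have hbound : (∑ i, (L i : ℝ)) - g ≤ 2 * α * OPT := by
    refine le_of_mul_le_mul_right ?_ hBmin
    calc ((∑ i, (L i : ℝ)) - g) * Bmin ≤ 2 * (OPT * Bmax) := by linarith
      _ = 2 * α * OPT * Bmin := by rw [← hαB]; ring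
  linarith
end
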